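/- Let 0 < a < b be real numbers, 0 < α ≤ 1, p > 1 and q = p/(p−1). Then |24·A(a,b)^{α+4} − 24·L_{α+4}(a,b) + (b−a)²·(α+3)(α+4)·L_{α+2}(a,b)| ≤ ((b−a)³/4)·(1/(p+1))^{1/p}·(α+2)(α+3)(α+4)·(max{a^{(α+1)q}, b^{(α+1)q}})^{1/q}. -/

import Mathlib

noncomputable def arithMean (x y : ℝ) : ℝ := (x + y) / 2

noncomputable def genLogMean (p a b : ℝ) : ℝ :=
  (b ^ (p + 1) - a ^ (p + 1)) / ((p + 1) * (b - a))

theorem aux_mono (c : ℝ) (f f' : ℝ → ℝ) (h0 : 0 ≤ f 0)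
    (hd : ∀ t ∈ Set.Icc 0 c, HasDerivAt f (f' t) t)
    (hn : ∀ t ∈ Set.Icc 0 c, 0 ≤ f' t) : ∀ t ∈ Set.Icc 0 c, 0 ≤ f t := by
  intro t ht
  have hm : MonotoneOn f (Set.Icc 0 c) := by
    apply monotoneOn_of_deriv_nonneg (convex_Icc 0 c)
    · exact fun x hx => (hd x hx).continuousAt.continuousWithinAt
    · exact fun x hx => (hd x (interior_subset hx)).differentiableAt.differentiableWithinAt
    · intro x hx
      rw [(hd x (interior_subset hx)).deriv]
      exact hn x (interior_subset hx)
  exact h0.trans (hm ⟨le_refl _, ht.1.trans ht.2⟩ ht ht.1)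

theorem aux_main (m c M : ℝ) (hc : 0 ≤ c) (hcm : c < m) (F f f1 f2 f3 : ℝ → ℝ)
    (hF : ∀ x, 0 < x → HasDerivAt F (f x) x)
    (hf : ∀ x, 0 < x → HasDerivAt f (f1 x) x)
    (hf1 : ∀ x, 0 < x → HasDerivAt f1 (f2 x) x)
    (hf2 : ∀ x, 0 < x → HasDerivAt f2 (f3 x) x)
    (hpos : ∀ x, 0 < x → 0 ≤ f3 x)
    (hM : ∀ x, 0 < x → x ≤ m + c → f3 x ≤ M)
    (hmono : ∀ x y, 0 < x → x ≤ y → f3 x ≤ f3 y) :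
    0 ≤ 48 * c * f m - 24 * (F (m + c) - F (m - c)) + 4 * c ^ 2 * (f1 (m + c) - f1 (m - c)) ∧
    48 * c * f m - 24 * (F (m + c) - F (m - c)) + 4 * c ^ 2 * (f1 (m + c) - f1 (m - c))
      ≤ M * c ^ 4 := by
  have plus : ∀ g g' : ℝ → ℝ, (∀ x, 0 < x → HasDerivAt g (g' x) x) → ∀ t ∈ Set.Icc 0 c,
      HasDerivAt (fun t => g (m + t)) (g' (m + t)) t := by
    intro g g' h t ht
    exact (h (m + t) (by linarith [ht.1])).comp_const_add m t
  have minus : ∀ g g' : ℝ → ℝ, (∀ x, 0 < x → HasDerivAt g (g' x) x) → ∀ t ∈ Set.Icc 0 c,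
      HasDerivAt (fun t => g (m - t)) (-g' (m - t)) t := by
    intro g g' h t ht
    exact (h (m - t) (by linarith [ht.2])).comp_const_sub m t
  have pw : ∀ n : ℕ, ∀ t : ℝ, HasDerivAt (fun t : ℝ => t ^ n) (n * t ^ (n - 1)) t :=
    fun n t => hasDerivAt_pow n t
  have D0 : ∀ t ∈ Set.Icc 0 c, 0 ≤ f3 (m + t) - f3 (m - t) := fun t ht =>
    sub_nonneg.2 (hmono _ _ (by linarith [ht.2]) (by linarith [ht.1]))
  have D1 : ∀ t ∈ Set.Icc 0 c, f3 (m + t) - f3 (m - t) ≤ M := fun t ht => by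
    linarith [hM (m + t) (by linarith [ht.1]) (by linarith [ht.2]),
      hpos (m - t) (by linarith [ht.2])]
  have dG : ∀ t ∈ Set.Icc 0 c, HasDerivAt
      (fun t => t * (f2 (m + t) + f2 (m - t)) - (f1 (m + t) - f1 (m - t)))
      (t * (f3 (m + t) - f3 (m - t))) t := by
    intro t ht
    convert! ((hasDerivAt_id t).mul ((plus _ _ hf2 t ht).add (minus _ _ hf2 t ht))).sub
      ((plus _ _ hf1 t ht).sub (minus _ _ hf1 t ht)) using 1
    simp only [id, Pi.add_apply]
    ring
  have d1 : ∀ t ∈ Set.Icc 0 c, HasDerivAt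
      (fun t => 48 * f m - 24 * (f (m + t) + f (m - t)) + 8 * t * (f1 (m + t) - f1 (m - t))
        + 4 * t ^ 2 * (f2 (m + t) + f2 (m - t)))
      (16 * (t * (f2 (m + t) + f2 (m - t)) - (f1 (m + t) - f1 (m - t)))
        + 4 * t ^ 2 * (f3 (m + t) - f3 (m - t))) t := by
    intro t ht
    convert! (((((plus _ _ hf t ht).add (minus _ _ hf t ht)).const_mul 24).const_sub
      (48 * f m)).add ((((hasDerivAt_id t).const_mul 8).mul
        ((plus _ _ hf1 t ht).sub (minus _ _ hf1 t ht))))).add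
      (((pw 2 t).const_mul 4).mul ((plus _ _ hf2 t ht).add (minus _ _ hf2 t ht))) using 1
    simp; ring
  have d0 : ∀ t ∈ Set.Icc 0 c, HasDerivAt
      (fun t => 48 * t * f m - 24 * (F (m + t) - F (m - t))
        + 4 * t ^ 2 * (f1 (m + t) - f1 (m - t)))
      (48 * f m - 24 * (f (m + t) + f (m - t)) + 8 * t * (f1 (m + t) - f1 (m - t))
        + 4 * t ^ 2 * (f2 (m + t) + f2 (m - t))) t := by
    intro t ht
    convert! ((((hasDerivAt_id t).const_mul 48).mul_const (f m)).sub
      (((plus _ _ hF t ht).sub (minus _ _ hF t ht)).const_mul 24)).add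
      (((pw 2 t).const_mul 4).mul ((plus _ _ hf1 t ht).sub (minus _ _ hf1 t ht))) using 1
    simp; ring
  have G0 := aux_mono c _ _ (by simp) dG (fun t ht => mul_nonneg ht.1 (D0 t ht))
  have G1 := aux_mono c _ _ (by simp)
    (fun t ht => ((pw 2 t).const_mul (M / 2)).sub (dG t ht))
    (fun t ht => by
      have := mul_le_mul_of_nonneg_left (D1 t ht) ht.1
      norm_num; linarith)
  have H0 := aux_mono c _ _ (by simp; linarith) d1 (fun t ht => by
    have := G0 t ht
    have := mul_nonneg (sq_nonneg t) (D0 t ht)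
    beta_reduce at *
    linarith)
  have H1 := aux_mono c _ _ (by simp; linarith)
    (fun t ht => ((pw 3 t).const_mul (4 * M)).sub (d1 t ht))
    (fun t ht => by
      have h1 := G1 t ht
      have h2 := mul_le_mul_of_nonneg_left (D1 t ht) (sq_nonneg t)
      simp only [Pi.sub_apply] at h1
      norm_num; linarith)
  have K0 := aux_mono c _ _ (by simp) d0 H0
  have K1 := aux_mono c _ _ (by simp)
    (fun t ht => ((pw 4 t).const_mul M).sub (d0 t ht))
    (fun t ht => by
      have h1 := H1 t ht
      simp only [Pi.sub_apply] at h1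
      norm_num; linarith)
  refine ⟨K0 c ⟨hc, le_refl _⟩, ?_⟩
  have h1 := K1 c ⟨hc, le_refl _⟩
  simp only [Pi.sub_apply] at h1
  linarith

theorem aux_const (p : ℝ) (hp : 1 < p) : 1 / 2 ≤ (1 / (p + 1)) ^ (1 / p) := by
  have h := one_add_mul_self_le_rpow_one_add (s := 1) (by norm_num) hp.le
  have hp0 : 0 < p := by linarith
  have h2 : ((1:ℝ) / 2) ^ p ≤ 1 / (p + 1) := by
    rw [Real.div_rpow (by norm_num) (by norm_num), Real.one_rpow]
    apply one_div_le_one_div_of_le (by linarith)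
    norm_num at h; linarith
  calc (1:ℝ) / 2 = ((1 / 2) ^ p) ^ (1 / p) := by
        rw [← Real.rpow_mul (by norm_num), mul_one_div_cancel hp0.ne', Real.rpow_one]
    _ ≤ _ := Real.rpow_le_rpow (by positivity) h2 (by positivity)

theorem means_midpoint_third_deriv_quasiconvex_holder (a b α p q : ℝ)
    (ha : 0 < a) (hab : a < b) (hα0 : 0 < α) (hα1 : α ≤ 1)
    (hp : 1 < p) (hq : q = p / (p - 1)) :
    |24 * arithMean a b ^ (α + 4) - 24 * genLogMean (α + 4) a b
        + (b - a) ^ 2 * (α + 3) * (α + 4) * genLogMean (α + 2) a b|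
      ≤ ((b - a) ^ 3 / 4) * (1 / (p + 1)) ^ (1 / p) *
          (α + 2) * (α + 3) * (α + 4) *
          (max (a ^ ((α + 1) * q)) (b ^ ((α + 1) * q))) ^ (1 / q) := by


  have hp0 : 0 < p := by linarith
  have hq0 : 0 < q := by rw [hq]; exact div_pos hp0 (by linarith)
  have hb : 0 < b := ha.trans hab
  have hmax : (max (a ^ ((α + 1) * q)) (b ^ ((α + 1) * q))) ^ (1 / q) = b ^ (α + 1) := by
    rw [max_eq_right (Real.rpow_le_rpow ha.le hab.le (by positivity)), ← Real.rpow_mul hb.le,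
      mul_assoc, mul_one_div_cancel hq0.ne', mul_one]
  rw [hmax]
  have dpow : ∀ C s r : ℝ, r = s - 1 → ∀ x : ℝ, 0 < x →
      HasDerivAt (fun x : ℝ => C * x ^ s) (C * s * x ^ r) x := by
    intro C s r hr x hx
    have := (Real.hasDerivAt_rpow_const (p := s) (Or.inl hx.ne')).const_mul C
    rw [hr]
    convert! this using 1
    ring
  have key := aux_main ((a + b) / 2) ((b - a) / 2)
    ((α + 4) * (α + 3) * (α + 2) * b ^ (α + 1)) (by linarith) (by linarith)
    (fun x => 1 / (α + 5) * x ^ (α + 5)) (fun x => x ^ (α + 4))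
    (fun x => (α + 4) * x ^ (α + 3)) (fun x => (α + 4) * (α + 3) * x ^ (α + 2))
    (fun x => (α + 4) * (α + 3) * (α + 2) * x ^ (α + 1))
    (fun x hx => by
      have := dpow (1 / (α + 5)) (α + 5) (α + 4) (by ring) x hx
      rwa [one_div_mul_cancel (by positivity), one_mul] at this)
    (fun x hx => by simpa using dpow 1 (α + 4) (α + 3) (by ring) x hx)
    (fun x hx => dpow _ _ _ (by ring) x hx)
    (fun x hx => dpow _ _ _ (by ring) x hx)
    (fun x hx => by positivity)
    (fun x hx hxb => by
      have : x ≤ b := by linarith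
      gcongr)
    (fun x y hx hxy => by
      show _ * _ ≤ _ * _
      gcongr)
  have e1 : (a + b) / 2 + (b - a) / 2 = b := by ring
  have e2 : (a + b) / 2 - (b - a) / 2 = a := by ring
  simp only [e1, e2] at key
  have hh : 0 < b - a := by linarith
  have hE : 24 * arithMean a b ^ (α + 4) - 24 * genLogMean (α + 4) a b
        + (b - a) ^ 2 * (α + 3) * (α + 4) * genLogMean (α + 2) a b
      = (48 * ((b - a) / 2) * ((a + b) / 2) ^ (α + 4)
        - 24 * (1 / (α + 5) * b ^ (α + 5) - 1 / (α + 5) * a ^ (α + 5))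
        + 4 * ((b - a) / 2) ^ 2 * ((α + 4) * b ^ (α + 3) - (α + 4) * a ^ (α + 3))) / (b - a) := by
    unfold arithMean genLogMean
    rw [show α + 4 + 1 = α + 5 by ring, show α + 2 + 1 = α + 3 by ring]
    have : α + 5 ≠ 0 := by positivity
    have : α + 3 ≠ 0 := by positivity
    have := hh.ne'
    generalize ((a + b) / 2) ^ (α + 4) = X
    field_simp
    ring
  rw [hE, abs_of_nonneg (div_nonneg key.1 hh.le), div_le_iff₀ hh]
  refine key.2.trans ?_
  have hc := aux_const p hp
  have hW : 0 ≤ (b - a) ^ 4 / 4 * ((α + 4) * (α + 3) * (α + 2) * b ^ (α + 1)) := by positivity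
  have := mul_le_mul_of_nonneg_left hc hW
  nlinarith
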